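/- arXiv:2212.04228 — 2 statements merged into one kernel-verified Lean document; each statement's English description precedes it below -/
import Mathlib

section
/- Let W = ℂ⁶ with basis e₁,...,e₆, let ω be the symplectic form with ω(e₁,e₂) = ω(e₃,e₄) = ω(e₅,e₆) = 1 and ω(eᵢ,eⱼ) = 0 for all other pairs i < j, and let ω̂ = e₁∧e₂ + e₃∧e₄ + e₅∧e₆ ∈ ⋀²W. Let tr : ⋀²W → ℂ be the linear map with tr(x∧y) = ω(x,y) and set ⋀^⟨2⟩W = ker tr (of dimension 14). For nonzero v ∈ W, let φ_v : ⋀^⟨2⟩W → ⋀³W / (ω̂ ∧ W) be the map ξ ↦ v ∧ ξ mod ω̂ ∧ W, where ω̂ ∧ W = {ω̂ ∧ w : w ∈ W}. Then ker φ_v = { v ∧ w − (ω(v,w)/3)·ω̂ : w ∈ W }, this kernel is 5-dimensional, and rank φ_v = 9 for every nonzero v ∈ W. -/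
open Module LinearMap ExteriorAlgebra

/-- `W = ℂ⁶`. -/
abbrev W6 : Type := Fin 6 → ℂ

/-- The standard basis vectors of `ℂ⁶`. -/
noncomputable def e6 (i : Fin 6) : W6 := Pi.single i 1

/-- The second exterior power `⋀²W`, as a submodule of the exterior algebra. -/
noncomputable def lam2 : Submodule ℂ (ExteriorAlgebra ℂ W6) := ⋀[ℂ]^2 W6

/-- The standard symplectic form on `ℂ⁶`, with `ω(e₁,e₂) = ω(e₃,e₄) = ω(e₅,e₆) = 1` and all
other pairings (for `i < j`) equal to `0`. -/
noncomputable def symp : W6 →ₗ[ℂ] W6 →ₗ[ℂ] ℂ :=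
  LinearMap.mk₂ ℂ
    (fun x y => x 0 * y 1 - x 1 * y 0 + x 2 * y 3 - x 3 * y 2 + x 4 * y 5 - x 5 * y 4)
    (fun x x' y => by simp only [Pi.add_apply]; ring)
    (fun c x y => by simp only [Pi.smul_apply, smul_eq_mul]; ring)
    (fun x y y' => by simp only [Pi.add_apply]; ring)
    (fun c x y => by simp only [Pi.smul_apply, smul_eq_mul]; ring)

/-- The dual symplectic form `ω̂ = e₁∧e₂ + e₃∧e₄ + e₅∧e₆ ∈ ⋀²ℂ⁶`. -/
noncomputable def omegaHat : ExteriorAlgebra ℂ W6 :=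
  ι ℂ (e6 0) * ι ℂ (e6 1) + ι ℂ (e6 2) * ι ℂ (e6 3) + ι ℂ (e6 4) * ι ℂ (e6 5)

/-- The subspace `ω̂ ∧ W = {ω̂ ∧ w : w ∈ W}` of `⋀³ℂ⁶`, inside the exterior algebra. -/
noncomputable def omegaHatWedgeW : Submodule ℂ (ExteriorAlgebra ℂ W6) :=
  LinearMap.range ((LinearMap.mulLeft ℂ omegaHat) ∘ₗ (ι ℂ : W6 →ₗ[ℂ] ExteriorAlgebra ℂ W6))

/-- Rank-nullity over `ℂ`, with the instance path of `ℂ`-modules fixed. -/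
theorem finrank_range_add_finrank_ker_complex {V V₂ : Type*} [AddCommGroup V] [Module ℂ V]
    [AddCommGroup V₂] [Module ℂ V₂] [Module.Finite ℂ V] (f : V →ₗ[ℂ] V₂) :
    finrank ℂ (LinearMap.range f) + finrank ℂ (LinearMap.ker f) = finrank ℂ V :=
  LinearMap.finrank_range_add_finrank_ker f

theorem exists_dual_apply_eq_one {V : Type*} [AddCommGroup V] [Module ℂ V] {v : V} (hv : v ≠ 0) :
    ∃ d : Module.Dual ℂ V, d v = 1 := by
  obtain ⟨f, hf⟩ := not_forall.1 (mt (Module.forall_dual_apply_eq_zero_iff ℂ v).1 hv)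
  exact ⟨(f v)⁻¹ • f, by simp [hf]⟩

open CliffordAlgebra in
/-- An element annihilated by wedging with `v` is divisible by `v`: the quotient is its contraction
against any functional taking the value `1` at `v`. -/
theorem eq_ι_mul_contractLeft {V : Type*} [AddCommGroup V] [Module ℂ V] (d : Module.Dual ℂ V)
    {v : V} (hd : d v = 1) {ξ : ExteriorAlgebra ℂ V} (h : ExteriorAlgebra.ι ℂ v * ξ = 0) :
    ξ = ExteriorAlgebra.ι ℂ v * contractLeft d ξ := by
  have h1 := contractLeft_ι_mul (Q := (0 : QuadraticForm ℂ V)) d v ξ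
  rw [show CliffordAlgebra.ι (0 : QuadraticForm ℂ V) v * ξ = 0 from h, map_zero, hd,
    one_smul] at h1
  exact sub_eq_zero.1 h1.symm

section

variable {V : Type*} [AddCommGroup V] [Module ℂ V]

theorem ι_mul_ι_comm_neg (x y : V) : ι ℂ x * ι ℂ y = -(ι ℂ y * ι ℂ x) :=
  eq_neg_of_add_eq_zero_left (ι_add_mul_swap x y)

theorem commute_ι_mul_ι_ι (x y z : V) : Commute (ι ℂ x * ι ℂ y) (ι ℂ z) := by
  unfold Commute SemiconjBy
  rw [mul_assoc, ι_mul_ι_comm_neg y z, mul_neg, ← mul_assoc, ι_mul_ι_comm_neg x z]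
  simp [mul_assoc]

theorem commute_ι_mul_ι (x y z t : V) : Commute (ι ℂ x * ι ℂ y) (ι ℂ z * ι ℂ t) :=
  (commute_ι_mul_ι_ι x y z).mul_right (commute_ι_mul_ι_ι x y t)

theorem ι_mul_ι_mul_self (x y : V) : ι ℂ x * ι ℂ y * (ι ℂ x * ι ℂ y) = 0 := by
  rw [← mul_assoc, (commute_ι_mul_ι_ι x y x).eq, ← mul_assoc, ι_sq_zero, zero_mul, zero_mul]

theorem ι_mul_ι_mem_exteriorPower (x y : V) : ι ℂ x * ι ℂ y ∈ ⋀[ℂ]^2 V := by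
  rw [exteriorPower, pow_two]
  exact Submodule.mul_mem_mul ⟨x, rfl⟩ ⟨y, rfl⟩

theorem contractLeft_mem_range_ι (d : Module.Dual ℂ V) {ξ : ExteriorAlgebra ℂ V}
    (hξ : ξ ∈ ⋀[ℂ]^2 V) : ∃ u, CliffordAlgebra.contractLeft d ξ = ι ℂ u := by
  rw [exteriorPower, pow_two] at hξ
  refine Submodule.mul_induction_on hξ ?_ ?_
  · rintro _ ⟨x, rfl⟩ _ ⟨y, rfl⟩
    refine ⟨d x • y - d y • x, ?_⟩
    have h := CliffordAlgebra.contractLeft_ι_mul (Q := (0 : QuadraticForm ℂ V)) d x (ι ℂ y)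
    have h' := CliffordAlgebra.contractLeft_ι (Q := (0 : QuadraticForm ℂ V)) d y
    refine h.trans ?_
    rw [show CliffordAlgebra.contractLeft d (ι ℂ y) = algebraMap ℂ _ (d y) from h',
      ← Algebra.commutes, ← Algebra.smul_def, map_sub, map_smul, map_smul]
  · rintro x y ⟨u, hu⟩ ⟨u', hu'⟩
    exact ⟨u + u', by rw [map_add, hu, hu', map_add]⟩

theorem exists_eq_ι_mul_ι {v : V} (hv : v ≠ 0) {ξ : ExteriorAlgebra ℂ V} (hξ : ξ ∈ ⋀[ℂ]^2 V)
    (h : ι ℂ v * ξ = 0) : ∃ u, ξ = ι ℂ v * ι ℂ u := by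
  obtain ⟨d, hd⟩ := exists_dual_apply_eq_one hv
  obtain ⟨u, hu⟩ := contractLeft_mem_range_ι d hξ
  exact ⟨u, hu ▸ eq_ι_mul_contractLeft d hd h⟩

theorem exists_eq_smul_of_ι_mul_ι_eq_zero {v w : V} (hv : v ≠ 0) (h : ι ℂ v * ι ℂ w = 0) :
    ∃ c : ℂ, w = c • v := by
  obtain ⟨d, hd⟩ := exists_dual_apply_eq_one hv
  refine ⟨d w, (ι_leftInverse (R := ℂ) (M := V)).injective ?_⟩
  rw [eq_ι_mul_contractLeft d hd h,
    show CliffordAlgebra.contractLeft d (ι ℂ w) = algebraMap ℂ _ (d w) from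
      CliffordAlgebra.contractLeft_ι (Q := (0 : QuadraticForm ℂ V)) d w,
    ← Algebra.commutes, ← Algebra.smul_def, map_smul]

/-- If `v ∧ w ≠ 0` and `v ∧ w ∧ ξ = 0` for a bivector `ξ`, then `ξ ∈ v ∧ V + w ∧ V`. -/
theorem exists_eq_ι_mul_ι_add_ι_mul_ι {v w : V} (hvw : ι ℂ v * ι ℂ w ≠ 0)
    {ξ : ExteriorAlgebra ℂ V} (hξ : ξ ∈ ⋀[ℂ]^2 V) (h : ι ℂ v * (ι ℂ w * ξ) = 0) :
    ∃ a b, ξ = ι ℂ v * ι ℂ a + ι ℂ w * ι ℂ b := by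
  have hv : v ≠ 0 := by
    rintro rfl
    simp at hvw
  obtain ⟨d, hd⟩ := exists_dual_apply_eq_one hv
  obtain ⟨u, hu⟩ := contractLeft_mem_range_ι d hξ
  have h1 : ι ℂ w * ξ = ι ℂ v * (d w • ξ - ι ℂ w * ι ℂ u) := by
    have h2 := CliffordAlgebra.contractLeft_ι_mul (Q := (0 : QuadraticForm ℂ V)) d w ξ
    rw [hu] at h2
    exact (eq_ι_mul_contractLeft d hd h).trans (congrArg (ι ℂ v * ·) h2)
  have hw' : w - d w • v ≠ 0 := by
    intro h0
    rw [sub_eq_zero.1 h0] at hvw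
    simp at hvw
  have h3 : ι ℂ (w - d w • v) * (ξ - ι ℂ v * ι ℂ u) = 0 := by
    have h4 : ι ℂ v * (ι ℂ v * ι ℂ u) = 0 := by rw [← mul_assoc, ι_sq_zero, zero_mul]
    have h5 : ι ℂ w * (ι ℂ v * ι ℂ u) = -(ι ℂ v * (ι ℂ w * ι ℂ u)) := by
      rw [← mul_assoc, ι_mul_ι_comm_neg w v, neg_mul, mul_assoc]
    simp only [map_sub, map_smul, sub_mul, mul_sub, smul_mul_assoc, h4, h5, h1, mul_smul_comm]
    simp
  obtain ⟨b, hb⟩ := exists_eq_ι_mul_ι hw' (sub_mem hξ (ι_mul_ι_mem_exteriorPower v u)) h3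
  refine ⟨u - d w • b, b, ?_⟩
  rw [sub_eq_iff_eq_add.1 hb]
  simp only [map_sub, map_smul, sub_mul, mul_sub, smul_mul_assoc, mul_smul_comm]
  abel

end

theorem omegaHat_mem : omegaHat ∈ ⋀[ℂ]^2 W6 :=
  add_mem (add_mem (ι_mul_ι_mem_exteriorPower _ _) (ι_mul_ι_mem_exteriorPower _ _))
    (ι_mul_ι_mem_exteriorPower _ _)

theorem commute_omegaHat_ι (w : W6) : Commute omegaHat (ι ℂ w) :=
  ((commute_ι_mul_ι_ι _ _ _).add_left (commute_ι_mul_ι_ι _ _ _)).add_left (commute_ι_mul_ι_ι _ _ _)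

theorem cube_add_eq_zero {R : Type*} [Ring R] {a b : R} (h : Commute a b) (ha : a * a = 0)
    (hb : b * b = 0) : (a + b) ^ 3 = 0 := by
  rw [← pow_two] at ha hb
  rw [h.add_pow]
  simp [Finset.sum_range_succ, ha, hb, pow_succ a 2, pow_succ b 2]

theorem cube_add_add {R : Type*} [Ring R] {a b c : R} (hab : Commute a b) (hac : Commute a c)
    (hbc : Commute b c) (ha : a * a = 0) (hb : b * b = 0) (hc : c * c = 0) :
    (a + b + c) ^ 3 = (6 : ℕ) • (a * b * c) := by
  have h2 : (a + b + c) * (a + b + c) = (2 : ℕ) • (a * b + a * c + b * c) := by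
    simp only [mul_add, add_mul, ha, hb, hc, hab.eq, hac.eq, hbc.eq]
    abel
  rw [pow_succ, pow_two, h2]
  have e1 : a * b * a = 0 := by rw [hab.eq, mul_assoc, ha, mul_zero]
  have e2 : a * c * a = 0 := by rw [hac.eq, mul_assoc, ha, mul_zero]
  have e3 : b * c * a = a * b * c := by rw [mul_assoc, ← hac.eq, ← mul_assoc, ← hab.eq]
  have e4 : a * b * b = 0 := by rw [mul_assoc, hb, mul_zero]
  have e5 : a * c * b = a * b * c := by rw [mul_assoc, ← hbc.eq, ← mul_assoc]
  have e6 : b * c * b = 0 := by rw [hbc.eq, mul_assoc, hb, mul_zero]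
  have e7 : a * c * c = 0 := by rw [mul_assoc, hc, mul_zero]
  have e8 : b * c * c = 0 := by rw [mul_assoc, hc, mul_zero]
  simp only [smul_mul_assoc, mul_add, add_mul, e1, e2, e3, e4, e5, e6, e7, e8]
  abel

/-- Contracting `eⱼ ∧ x` against the `i`-th coordinate functional. -/
theorem contractLeft_proj_ι_e6_mul (i j : Fin 6) (x : ExteriorAlgebra ℂ W6) :
    CliffordAlgebra.contractLeft (Q := (0 : QuadraticForm ℂ W6))
      (LinearMap.proj i : Module.Dual ℂ W6) (ι ℂ (e6 j) * x) =
      (if i = j then (1 : ℂ) else 0) • x - ι ℂ (e6 j) * CliffordAlgebra.contractLeft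
        (Q := (0 : QuadraticForm ℂ W6)) (LinearMap.proj i : Module.Dual ℂ W6) x := by
  refine (CliffordAlgebra.contractLeft_ι_mul _ _ _).trans ?_
  simp [e6, Pi.single_apply]

theorem omegaHat_cube_ne_zero : omegaHat ^ 3 ≠ 0 := by
  rw [omegaHat, cube_add_add (commute_ι_mul_ι _ _ _ _) (commute_ι_mul_ι _ _ _ _)
    (commute_ι_mul_ι _ _ _ _) (ι_mul_ι_mul_self _ _) (ι_mul_ι_mul_self _ _)
    (ι_mul_ι_mul_self _ _)]
  rw [← Nat.cast_smul_eq_nsmul ℂ]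
  refine smul_ne_zero (by norm_num) fun h => ?_
  rw [← mul_one (ι ℂ (e6 5))] at h
  have step : ∀ (i : Fin 6) (x : ExteriorAlgebra ℂ W6), x = 0 → CliffordAlgebra.contractLeft
      (Q := (0 : QuadraticForm ℂ W6)) (LinearMap.proj i : Module.Dual ℂ W6) x = 0 := by
    rintro i x rfl
    exact map_zero _
  have h5 := step 5 _ (step 4 _ (step 3 _ (step 2 _ (step 1 _ (step 0 _ h)))))
  simp [mul_assoc, contractLeft_proj_ι_e6_mul] at h5
  simp [e6] at h5

theorem ι_mul_omegaHat_ne_zero {v : W6} (hv : v ≠ 0) : ι ℂ v * omegaHat ≠ 0 := by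
  intro h
  obtain ⟨u, hu⟩ := exists_eq_ι_mul_ι hv omegaHat_mem h
  apply omegaHat_cube_ne_zero
  rw [hu, pow_succ, pow_two, ι_mul_ι_mul_self, zero_mul]

theorem ι_mul_ι_eq_zero_of_mul_omegaHat {v w : W6} (h : ι ℂ v * (ι ℂ w * omegaHat) = 0) :
    ι ℂ v * ι ℂ w = 0 := by
  by_contra hvw
  obtain ⟨a, b, hab⟩ := exists_eq_ι_mul_ι_add_ι_mul_ι hvw omegaHat_mem h
  apply omegaHat_cube_ne_zero
  rw [hab]
  exact cube_add_eq_zero (commute_ι_mul_ι _ _ _ _) (ι_mul_ι_mul_self _ _) (ι_mul_ι_mul_self _ _)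

/-- The map `w ↦ v ∧ w - (ω(v,w)/3) ω̂` parametrizing the kernel of wedging with `v`. -/
noncomputable def kernelMap (v : W6) : W6 →ₗ[ℂ] ExteriorAlgebra ℂ W6 :=
  LinearMap.mulLeft ℂ (ι ℂ v) ∘ₗ ι ℂ - ((3 : ℂ)⁻¹ • symp v).smulRight omegaHat

theorem kernelMap_apply (v w : W6) :
    kernelMap v w = ι ℂ v * ι ℂ w - (symp v w / 3) • omegaHat := by
  simp [kernelMap, div_eq_inv_mul]

theorem symp_self (v : W6) : symp v v = 0 := by
  simp only [symp, LinearMap.mk₂_apply]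
  ring

theorem ker_kernelMap {v : W6} (hv : v ≠ 0) : LinearMap.ker (kernelMap v) = ℂ ∙ v := by
  ext w
  rw [LinearMap.mem_ker, kernelMap_apply, Submodule.mem_span_singleton]
  constructor
  · intro h
    have h0 : (symp v w / 3) • (ι ℂ v * omegaHat) = 0 := by
      rw [← mul_smul_comm, ← sub_eq_zero.1 h, ← mul_assoc, ι_sq_zero, zero_mul]
    rw [(smul_eq_zero.1 h0).resolve_right (ι_mul_omegaHat_ne_zero hv), zero_smul, sub_zero] at h
    obtain ⟨c, hc⟩ := exists_eq_smul_of_ι_mul_ι_eq_zero hv h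
    exact ⟨c, hc.symm⟩
  · rintro ⟨c, rfl⟩
    simp [symp_self]

theorem finrank_range_kernelMap {v : W6} (hv : v ≠ 0) :
    finrank ℂ (LinearMap.range (kernelMap v)) = 5 := by
  have h := LinearMap.finrank_range_add_finrank_ker (kernelMap v)
  rw [ker_kernelMap hv, finrank_span_singleton hv, Module.finrank_fin_fun] at h
  omega

theorem kernelMap_mem (v w : W6) : kernelMap v w ∈ lam2 := by
  rw [kernelMap_apply]
  exact sub_mem (ι_mul_ι_mem_exteriorPower _ _) (Submodule.smul_mem _ _ omegaHat_mem)

theorem trace_omegaHat {tr : lam2 →ₗ[ℂ] ℂ} (htr : ∀ (z : lam2) (x y : W6),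
    (z : ExteriorAlgebra ℂ W6) = ι ℂ x * ι ℂ y → tr z = symp x y) :
    tr ⟨omegaHat, omegaHat_mem⟩ = 3 := by
  have hsum : (⟨omegaHat, omegaHat_mem⟩ : lam2) =
      (⟨_, ι_mul_ι_mem_exteriorPower (e6 0) (e6 1)⟩ : lam2) +
        (⟨_, ι_mul_ι_mem_exteriorPower (e6 2) (e6 3)⟩ : lam2) +
        (⟨_, ι_mul_ι_mem_exteriorPower (e6 4) (e6 5)⟩ : lam2) := rfl
  rw [hsum, map_add, map_add, htr _ _ _ rfl, htr _ _ _ rfl, htr _ _ _ rfl]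
  simp [symp, e6]
  norm_num

theorem trace_kernelMap {tr : lam2 →ₗ[ℂ] ℂ} (htr : ∀ (z : lam2) (x y : W6),
    (z : ExteriorAlgebra ℂ W6) = ι ℂ x * ι ℂ y → tr z = symp x y) (v w : W6) :
    tr ⟨kernelMap v w, kernelMap_mem v w⟩ = 0 := by
  have hsum : (⟨kernelMap v w, kernelMap_mem v w⟩ : lam2) =
      (⟨_, ι_mul_ι_mem_exteriorPower v w⟩ : lam2) -
        (symp v w / 3) • (⟨omegaHat, omegaHat_mem⟩ : lam2) := Subtype.ext (kernelMap_apply v w)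
  rw [hsum, map_sub, map_smul, trace_omegaHat htr, htr _ _ _ rfl, smul_eq_mul]
  ring

theorem finrank_ker_trace {tr : lam2 →ₗ[ℂ] ℂ} (htr : ∀ (z : lam2) (x y : W6),
    (z : ExteriorAlgebra ℂ W6) = ι ℂ x * ι ℂ y → tr z = symp x y) :
    finrank ℂ (LinearMap.ker tr) = 14 := by
  have : Module.Finite ℂ lam2 := inferInstanceAs (Module.Finite ℂ (⋀[ℂ]^2 W6))
  have hdim : finrank ℂ lam2 = 15 := by
    have h : finrank ℂ (⋀[ℂ]^2 W6) = 15 := by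
      rw [exteriorPower.finrank_eq, Module.finrank_fin_fun]
      rfl
    exact h
  have hrange : LinearMap.range tr = ⊤ := by
    refine LinearMap.range_eq_top.2 (LinearMap.surjective fun h => ?_)
    have h3 := trace_omegaHat htr
    rw [h, LinearMap.zero_apply] at h3
    norm_num at h3
  have h := LinearMap.finrank_range_add_finrank_ker tr
  rw [hrange, finrank_top, Module.finrank_self, hdim] at h
  omega

/-- For a trace-free bivector `ξ`, `v ∧ ξ ∈ ω̂ ∧ W` if and only if `ξ` is in the range of
`kernelMap v`. -/
theorem ι_mul_mem_omegaHatWedgeW_iff {tr : lam2 →ₗ[ℂ] ℂ} (htr : ∀ (z : lam2) (x y : W6),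
    (z : ExteriorAlgebra ℂ W6) = ι ℂ x * ι ℂ y → tr z = symp x y) {v : W6} (hv : v ≠ 0)
    {ξ : lam2} (hξ : tr ξ = 0) :
    ι ℂ v * (ξ : ExteriorAlgebra ℂ W6) ∈ omegaHatWedgeW ↔
      ∃ w, (ξ : ExteriorAlgebra ℂ W6) = kernelMap v w := by
  constructor
  · rintro ⟨w, hw⟩
    replace hw : omegaHat * ι ℂ w = ι ℂ v * ξ := hw
    have h0 : ι ℂ v * (ι ℂ w * omegaHat) = 0 := by
      rw [← (commute_omegaHat_ι w).eq, hw, ← mul_assoc, ι_sq_zero, zero_mul]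
    obtain ⟨c, rfl⟩ := exists_eq_smul_of_ι_mul_ι_eq_zero hv (ι_mul_ι_eq_zero_of_mul_omegaHat h0)
    have h1 : ι ℂ v * (ξ - c • omegaHat) = 0 := by
      rw [mul_sub, ← hw, map_smul, mul_smul_comm, mul_smul_comm, (commute_omegaHat_ι v).eq,
        sub_self]
    obtain ⟨u, hu⟩ := exists_eq_ι_mul_ι hv
      (sub_mem ξ.2 (Submodule.smul_mem _ c omegaHat_mem)) h1
    have h2 := htr (ξ - c • ⟨omegaHat, omegaHat_mem⟩) v u hu
    rw [map_sub, map_smul, hξ, trace_omegaHat htr, smul_eq_mul] at h2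
    refine ⟨u, ?_⟩
    rw [kernelMap_apply, ← hu, ← h2, sub_sub, ← add_smul]
    ring_nf
    simp
  · rintro ⟨w, hw⟩
    refine ⟨-(symp v w / 3) • v, ?_⟩
    rw [hw, kernelMap_apply, mul_sub, ← mul_assoc, ι_sq_zero, zero_mul, zero_sub, mul_smul_comm,
      ← (commute_omegaHat_ι v).eq]
    simp

/-- For every trace map `tr : ⋀²W → ℂ` with `tr(x∧y) = ω(x,y)` (whose kernel is the
14-dimensional space `⋀^⟨2⟩W` of primitive 2-forms) and every nonzero `v ∈ W = ℂ⁶`, the map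
`φ_v : ⋀^⟨2⟩W → ⋀³W/(ω̂ ∧ W)`, `ξ ↦ v ∧ ξ mod ω̂ ∧ W`, has kernel
`{v ∧ w − (ω(v,w)/3)·ω̂ : w ∈ W}`, this kernel is `5`-dimensional, and `rank φ_v = 9`. -/
theorem sp6_primitive_two_forms_constant_rank
    (tr : lam2 →ₗ[ℂ] ℂ)
    (htr : ∀ (z : lam2) (x y : W6),
      (z : ExteriorAlgebra ℂ W6) = ι ℂ x * ι ℂ y → tr z = symp x y)
    (v : W6) (hv : v ≠ 0) :
    finrank ℂ (LinearMap.ker tr) = 14 ∧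
      (∀ κ : LinearMap.ker tr,
        (omegaHatWedgeW.mkQ ∘ₗ (LinearMap.mulLeft ℂ (ι ℂ v)) ∘ₗ
            lam2.subtype ∘ₗ (LinearMap.ker tr).subtype) κ = 0 ↔
          ∃ w : W6, ((κ : lam2) : ExteriorAlgebra ℂ W6) =
            ι ℂ v * ι ℂ w - (symp v w / 3) • omegaHat) ∧
      finrank ℂ (LinearMap.ker (omegaHatWedgeW.mkQ ∘ₗ (LinearMap.mulLeft ℂ (ι ℂ v)) ∘ₗ
        lam2.subtype ∘ₗ (LinearMap.ker tr).subtype)) = 5 ∧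
      finrank ℂ (LinearMap.range (omegaHatWedgeW.mkQ ∘ₗ (LinearMap.mulLeft ℂ (ι ℂ v)) ∘ₗ
        lam2.subtype ∘ₗ (LinearMap.ker tr).subtype)) = 9 := by
  have hker : ∀ κ : LinearMap.ker tr,
      (omegaHatWedgeW.mkQ ∘ₗ (LinearMap.mulLeft ℂ (ι ℂ v)) ∘ₗ
        lam2.subtype ∘ₗ (LinearMap.ker tr).subtype) κ = 0 ↔
          ∃ w, ((κ : lam2) : ExteriorAlgebra ℂ W6) = kernelMap v w := fun κ =>
    (Submodule.Quotient.mk_eq_zero _).trans (ι_mul_mem_omegaHatWedgeW_iff htr hv κ.2)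
  have : Module.Finite ℂ lam2 := inferInstanceAs (Module.Finite ℂ (⋀[ℂ]^2 W6))
  have h5 : finrank ℂ (LinearMap.ker (omegaHatWedgeW.mkQ ∘ₗ (LinearMap.mulLeft ℂ (ι ℂ v)) ∘ₗ
      lam2.subtype ∘ₗ (LinearMap.ker tr).subtype)) = 5 := by
    have hinj : Function.Injective (lam2.subtype ∘ₗ (LinearMap.ker tr).subtype) :=
      Subtype.val_injective.comp Subtype.val_injective
    have hmap : Submodule.map (lam2.subtype ∘ₗ (LinearMap.ker tr).subtype)
        (LinearMap.ker (omegaHatWedgeW.mkQ ∘ₗ (LinearMap.mulLeft ℂ (ι ℂ v)) ∘ₗ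
          lam2.subtype ∘ₗ (LinearMap.ker tr).subtype)) = LinearMap.range (kernelMap v) := by
      ext x
      constructor
      · rintro ⟨κ, hκ, rfl⟩
        obtain ⟨w, hw⟩ := (hker κ).1 hκ
        exact ⟨w, hw.symm⟩
      · rintro ⟨w, rfl⟩
        exact ⟨⟨⟨kernelMap v w, kernelMap_mem v w⟩, trace_kernelMap htr v w⟩,
          (hker _).2 ⟨w, rfl⟩, rfl⟩
    rw [← finrank_range_kernelMap hv, (Submodule.equivMapOfInjective _ hinj _).finrank_eq, hmap]
  have h14 := finrank_ker_trace htr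
  refine ⟨h14, fun κ => ?_, h5, ?_⟩
  · simp only [hker, kernelMap_apply]
  · have h9 := finrank_range_add_finrank_ker_complex (V := LinearMap.ker tr)
      (V₂ := ExteriorAlgebra ℂ W6 ⧸ omegaHatWedgeW) (omegaHatWedgeW.mkQ ∘ₗ
      (LinearMap.mulLeft ℂ (ι ℂ v)) ∘ₗ lam2.subtype ∘ₗ (LinearMap.ker tr).subtype)
    omega
end

section
/- Let U and W be finite-dimensional complex vector spaces, let L ⊆ Hom(U,W) be a linear subspace, and let r be the maximal rank of elements of L. Define RND(L) = { B ∈ Hom(U,W) : B(ker A) ⊆ im A for every A ∈ L with rank A = r }. Then: (1) L ⊆ RND(L); (2) if RND(L) = L, then L is rank-critical: every linear subspace of Hom(U,W) strictly containing L contains an element of rank strictly greater than r. -/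
open Module LinearMap

/-- If `B` does not map `ker A` into `range A`, then some element of the pencil spanned by `A`
and `B` has rank strictly bigger than that of `A`. -/
theorem exists_finrank_range_lt_finrank_range_smul_add
    {K U W : Type*} [Field K] [Infinite K] [AddCommGroup U] [Module K U]
    [AddCommGroup W] [Module K W] [FiniteDimensional K W]
    {A B : U →ₗ[K] W} {u : U} (hu : u ∈ LinearMap.ker A) (hBu : B u ∉ LinearMap.range A) :
    ∃ c : K, finrank K (LinearMap.range A) < finrank K (LinearMap.range (c • A + B)) := by
  obtain ⟨s, hs⟩ := A.rangeRestrict.exists_rightInverse_of_surjective A.range_rangeRestrict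
  have hAs (y : LinearMap.range A) : A (s y) = y := congrArg Subtype.val (LinearMap.congr_fun hs y)
  let f : LinearMap.range A × K →ₗ[K] W :=
    (LinearMap.range A).subtype.coprod (LinearMap.toSpanSingleton K W (B u))
  let h : LinearMap.range A × K →ₗ[K] W := (B ∘ₗ s).coprod 0
  have hf : LinearMap.ker f = ⊥ := by
    refine LinearMap.ker_eq_bot'.2 ?_
    rintro ⟨y, k⟩ hyk
    have hyk : (y : W) + k • B u = 0 := by simpa [f] using hyk
    have hk : k = 0 := by
      by_contra hk
      refine hBu (((LinearMap.range A).smul_mem_iff hk).1 ?_)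
      rw [eq_neg_of_add_eq_zero_right hyk]
      exact neg_mem y.2
    subst hk
    simpa using hyk
  obtain ⟨g, hg⟩ := f.exists_leftInverse_of_injective hf
  obtain ⟨c, hc⟩ := (Module.End.finite_spectrum (-(g ∘ₗ h))).exists_notMem
  have hinj : Function.Injective (c • f + h) := by
    have hunit := spectrum.notMem_iff.1 hc
    have hcomp : algebraMap K (Module.End K (LinearMap.range A × K)) c - -(g ∘ₗ h) =
        g ∘ₗ (c • f + h) := by
      rw [LinearMap.comp_add, LinearMap.comp_smul, hg, sub_neg_eq_add]
      rfl
    rw [hcomp] at hunit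
    have hgi := ((Module.End.isUnit_iff _).1 hunit).injective
    rw [LinearMap.coe_comp] at hgi
    exact hgi.of_comp
  have hrange : LinearMap.range (c • f + h) ≤ LinearMap.range (c • A + B) := by
    rintro _ ⟨⟨y, k⟩, rfl⟩
    refine ⟨s y + (c * k) • u, ?_⟩
    simp [f, h, hAs, LinearMap.mem_ker.1 hu, mul_smul]
    abel
  refine ⟨c, lt_of_lt_of_le ?_ (Submodule.finrank_mono hrange)⟩
  rw [LinearMap.finrank_range_of_inj hinj, Module.finrank_prod, finrank_self]
  exact Nat.lt_succ_self _

/-- Draisma's rank-criticality criterion. Let `L ⊆ Hom(U,W)` be a linear space of linear maps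
of maximal rank `r`, and let `RND(L)` be its space of rank neutral directions, consisting of
those `B` with `B(ker A) ⊆ im A` for every `A ∈ L` of rank `r`. Then `L ⊆ RND(L)`, and if
`RND(L) = L` then `L` is rank-critical: any linear subspace of `Hom(U,W)` strictly containing
`L` contains an element of rank strictly bigger than `r`. -/
theorem rank_critical_of_rnd_eq
    {U W : Type*} [AddCommGroup U] [Module ℂ U] [FiniteDimensional ℂ U]
    [AddCommGroup W] [Module ℂ W] [FiniteDimensional ℂ W]
    (L : Submodule ℂ (U →ₗ[ℂ] W)) (r : ℕ)
    (hler : ∀ A ∈ L, finrank ℂ (LinearMap.range A) ≤ r)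
    (hmax : ∃ A ∈ L, finrank ℂ (LinearMap.range A) = r) :
    (L : Set (U →ₗ[ℂ] W)) ⊆
        {B : U →ₗ[ℂ] W | ∀ A ∈ L, finrank ℂ (LinearMap.range A) = r →
          ∀ u ∈ LinearMap.ker A, B u ∈ LinearMap.range A} ∧
      (({B : U →ₗ[ℂ] W | ∀ A ∈ L, finrank ℂ (LinearMap.range A) = r →
            ∀ u ∈ LinearMap.ker A, B u ∈ LinearMap.range A} : Set (U →ₗ[ℂ] W)) = L →
        ∀ L' : Submodule ℂ (U →ₗ[ℂ] W), L < L' →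
          ∃ B ∈ L', r < finrank ℂ (LinearMap.range B)) := by
  constructor
  · intro B hB A hA hr u hu
    by_contra hBu
    obtain ⟨c, hc⟩ := exists_finrank_range_lt_finrank_range_smul_add hu hBu
    exact (hr ▸ hc).not_ge (hler _ (L.add_mem (L.smul_mem c hA) hB))
  · intro hL L' hLL'
    obtain ⟨B, hB', hB⟩ := SetLike.exists_of_lt hLL'
    rw [← SetLike.mem_coe, ← hL] at hB
    simp only [Set.mem_ofPred_eq, not_forall] at hB
    obtain ⟨A, hA, hr, u, hu, hBu⟩ := hB
    obtain ⟨c, hc⟩ := exists_finrank_range_lt_finrank_range_smul_add hu hBu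
    exact ⟨c • A + B, L'.add_mem (L'.smul_mem c (hLL'.le hA)) hB', hr ▸ hc⟩
end
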